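/- Let m_1,…,m_n be positive integers, x = (x_1,…,x_n) ∈ ℤ^n and t_1,…,t_n ∈ ℂ. Then Σ_{(k_1,…,k_n)∈ℤ^n} ∏_{j=1}^n I_{x_j+m_j k_j}(t_j) = (1/(m_1⋯m_n)) Σ_{(k_1,…,k_n), 0 ≤ k_j ≤ m_j−1} ∏_{j=1}^n exp(t_j cos(2πk_j/m_j)) e^{2πi x_j k_j/m_j}. -/

import Mathlib

open scoped Real
open Complex

/-- The modified Bessel function of the first kind with integer order,
`I_x(t) = (1/π) ∫₀^π e^{t cos θ} cos(xθ) dθ`. -/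
noncomputable def besselI (x : ℝ) (t : ℂ) : ℂ :=
  (Real.pi : ℂ)⁻¹ * ∫ θ in (0:ℝ)..Real.pi, Complex.exp (t * Real.cos θ) * (Real.cos (x * θ) : ℂ)

/-- An absolutely convergent product of series indexed by a finite product of types. -/
theorem summable_norm_and_hasSum_pi_prod {R ι : Type*} [NormedCommRing R] [CompleteSpace R]
    (n : ℕ) (f : Fin n → ι → R) (hf : ∀ j, Summable fun i ↦ ‖f j i‖) :
    (Summable fun k : Fin n → ι ↦ ‖∏ j, f j (k j)‖) ∧
      HasSum (fun k : Fin n → ι ↦ ∏ j, f j (k j)) (∏ j, ∑' i, f j i) := by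
  induction n with
  | zero => exact ⟨.of_finite, by simp⟩
  | succ n ih =>
    obtain ⟨hs, hsum⟩ := ih (fun j ↦ f j.succ) fun j ↦ hf j.succ
    let e : ι × (Fin n → ι) ≃ (Fin (n + 1) → ι) := Fin.consEquiv fun _ : Fin (n + 1) ↦ ι
    have hcomp : (fun k : Fin (n + 1) → ι ↦ ∏ j, f j (k j)) ∘ e =
        fun p ↦ f 0 p.1 * ∏ j : Fin n, f j.succ (p.2 j) := by
      ext p
      simp [e, Fin.consEquiv, Fin.prod_univ_succ]
    have hnorm : Summable ((fun k : Fin (n + 1) → ι ↦ ‖∏ j, f j (k j)‖) ∘ e) := by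
      refine ((hf 0).mul_norm hs).congr fun p ↦ ?_
      exact congrArg norm (congrFun hcomp p).symm
    refine ⟨e.summable_iff.1 hnorm, e.hasSum_iff.1 ?_⟩
    rw [hcomp, Fin.prod_univ_succ]
    have h0 : HasSum (f 0) (∑' i, f 0 i) := (hf 0).of_norm.hasSum
    have hmul := summable_mul_of_summable_norm (hf 0) hs
    have hprod := h0.mul hsum hmul
    exact hprod

theorem norm_besselI_le (x : ℝ) (t : ℂ) : ‖besselI x t‖ ≤ Real.exp ‖t‖ := by
  have h : ‖∫ θ in (0:ℝ)..π, exp (t * Real.cos θ) * (Real.cos (x * θ) : ℂ)‖ ≤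
      Real.exp ‖t‖ * |π - 0| := by
    refine intervalIntegral.norm_integral_le_of_norm_le_const fun θ _ ↦ ?_
    rw [norm_mul, norm_real, Real.norm_eq_abs]
    refine (mul_le_of_le_one_right (norm_nonneg _) (Real.abs_cos_le_one _)).trans ?_
    refine (norm_exp_le_exp_norm _).trans (Real.exp_le_exp.2 ?_)
    rw [norm_mul, norm_real, Real.norm_eq_abs]
    exact mul_le_of_le_one_right (norm_nonneg _) (Real.abs_cos_le_one _)
  rw [sub_zero, abs_of_pos Real.pi_pos] at h
  rw [besselI, norm_mul, norm_inv, norm_real, Real.norm_of_nonneg Real.pi_pos.le,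
    inv_mul_le_iff₀ Real.pi_pos, mul_comm]
  exact h

theorem intCast_mul_besselI (n : ℤ) (t : ℂ) :
    (n : ℂ) * besselI n t = t / 2 * (besselI (n - 1) t - besselI (n + 1) t) := by
  have hu (θ : ℝ) : HasDerivAt (fun θ : ℝ ↦ exp (t * Real.cos θ))
      (exp (t * Real.cos θ) * (t * ((-Real.sin θ : ℝ) : ℂ))) θ :=
    ((Real.hasDerivAt_cos θ).ofReal_comp.const_mul t).cexp
  have hv (θ : ℝ) : HasDerivAt (fun θ : ℝ ↦ (Real.sin (n * θ) : ℂ))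
      ((Real.cos (n * θ) * n : ℝ) : ℂ) θ := by
    have := ((hasDerivAt_id θ).const_mul (n : ℝ)).sin.ofReal_comp
    simpa using this
  have key := intervalIntegral.integral_mul_deriv_eq_deriv_mul (a := 0) (b := π)
    (fun θ _ ↦ hu θ) (fun θ _ ↦ hv θ)
    ((by fun_prop : Continuous _).intervalIntegrable _ _)
    ((by fun_prop : Continuous _).intervalIntegrable _ _)
  have hintegrable (x : ℝ) : IntervalIntegrable
      (fun θ : ℝ ↦ exp (t * Real.cos θ) * (Real.cos (x * θ) : ℂ)) MeasureTheory.volume 0 π :=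
    (by fun_prop : Continuous _).intervalIntegrable _ _
  simp only [Real.sin_int_mul_pi, mul_zero, Real.sin_zero, ofReal_zero, sub_zero, zero_sub]
    at key
  have hleft : ∫ θ in (0:ℝ)..π, exp (t * Real.cos θ) * ((Real.cos (n * θ) * n : ℝ) : ℂ) =
      n * ∫ θ in (0:ℝ)..π, exp (t * Real.cos θ) * (Real.cos (n * θ) : ℂ) := by
    rw [← intervalIntegral.integral_const_mul]
    congr 1 with θ
    push_cast
    ring
  have hright : -∫ θ in (0:ℝ)..π, exp (t * Real.cos θ) * (t * ((-Real.sin θ : ℝ) : ℂ)) *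
        (Real.sin (n * θ) : ℂ) =
      t / 2 * ((∫ θ in (0:ℝ)..π, exp (t * Real.cos θ) * (Real.cos ((n - 1 : ℝ) * θ) : ℂ)) -
        ∫ θ in (0:ℝ)..π, exp (t * Real.cos θ) * (Real.cos ((n + 1 : ℝ) * θ) : ℂ)) := by
    rw [← intervalIntegral.integral_sub (hintegrable _) (hintegrable _),
      ← intervalIntegral.integral_const_mul, ← intervalIntegral.integral_neg]
    congr 1 with θ
    rw [sub_mul, add_mul, one_mul, Real.cos_sub, Real.cos_add]
    push_cast
    ring
  rw [hleft, hright] at key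
  simp only [besselI]
  linear_combination (π : ℂ)⁻¹ * key

theorem abs_mul_norm_besselI_le (n : ℤ) (t : ℂ) :
    |(n : ℝ)| * ‖besselI n t‖ ≤ ‖t‖ / 2 * (‖besselI (n - 1) t‖ + ‖besselI (n + 1) t‖) := by
  have h := congrArg norm (intCast_mul_besselI n t)
  rw [norm_mul, norm_mul, norm_div, norm_intCast, RCLike.norm_ofNat] at h
  rw [h]
  gcongr
  exact norm_sub_le _ _

theorem summable_norm_besselI (t : ℂ) : Summable fun n : ℤ ↦ ‖besselI n t‖ := by
  set C := ‖t‖ * Real.exp ‖t‖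
  have hdecay (n : ℤ) : |(n : ℝ)| * ‖besselI n t‖ ≤ C := by
    refine (abs_mul_norm_besselI_le n t).trans ?_
    calc _ ≤ ‖t‖ / 2 * (Real.exp ‖t‖ + Real.exp ‖t‖) := by
          gcongr <;> exact norm_besselI_le _ _
      _ = C := by ring
  have hnear (n k : ℤ) (hn : 2 ≤ |n|) (hk : |n| ≤ |k| + 1) :
      |(n : ℝ)| * ‖besselI k t‖ ≤ 2 * C := by
    have hle : |(n : ℝ)| ≤ 2 * |(k : ℝ)| := by
      exact_mod_cast (by omega : |n| ≤ 2 * |k|)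
    nlinarith [hdecay k, norm_nonneg (besselI k t)]
  refine Summable.of_norm_bounded_eventually
    ((Real.summable_one_div_int_pow.2 one_lt_two).mul_left (2 * ‖t‖ * C)) ?_
  filter_upwards [(Set.finite_Icc (-1 : ℤ) 1).compl_mem_cofinite] with n hn
  have hn2 : 2 ≤ |n| := by
    simp only [Set.mem_compl_iff, Set.mem_Icc] at hn
    grind
  have h1 := hnear n (n - 1) hn2 (by grind)
  have h2 := hnear n (n + 1) hn2 (by grind)
  push_cast at h1 h2
  have hpos : 0 < |(n : ℝ)| := by exact_mod_cast (by omega : 0 < |n|)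
  rw [norm_norm, mul_one_div, ← sq_abs, le_div_iff₀ (by positivity)]
  calc ‖besselI n t‖ * |(n : ℝ)| ^ 2 = |(n : ℝ)| * (|(n : ℝ)| * ‖besselI n t‖) := by ring
    _ ≤ |(n : ℝ)| * (‖t‖ / 2 * (‖besselI (n - 1) t‖ + ‖besselI (n + 1) t‖)) := by
        refine mul_le_mul_of_nonneg_left ?_ hpos.le
        exact abs_mul_norm_besselI_le n t
    _ = ‖t‖ / 2 * (|(n : ℝ)| * ‖besselI (n - 1) t‖ + |(n : ℝ)| * ‖besselI (n + 1) t‖) := by ring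
    _ ≤ ‖t‖ / 2 * (2 * C + 2 * C) := by gcongr
    _ = 2 * ‖t‖ * C := by ring

theorem integral_exp_mul_exp_cos (n : ℤ) (t : ℂ) :
    ∫ θ in (-π)..π, exp (-(n * θ * I)) * exp (t * Real.cos θ) = 2 * π * besselI n t := by
  have hintegrable (a b : ℝ) : IntervalIntegrable
      (fun θ : ℝ ↦ exp (-(n * θ * I)) * exp (t * Real.cos θ)) MeasureTheory.volume a b :=
    (by fun_prop : Continuous _).intervalIntegrable _ _
  have hintegrable_neg : IntervalIntegrable
      (fun θ : ℝ ↦ exp (-(n * (-θ : ℝ) * I)) * exp (t * Real.cos (-θ)))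
      MeasureTheory.volume 0 π :=
    (by fun_prop : Continuous _).intervalIntegrable _ _
  have hneg := intervalIntegral.integral_comp_neg (a := 0) (b := π)
    fun θ : ℝ ↦ exp (-(n * θ * I)) * exp (t * Real.cos θ)
  rw [neg_zero] at hneg
  rw [← intervalIntegral.integral_add_adjacent_intervals (hintegrable (-π) 0) (hintegrable 0 π), ← hneg,
    ← intervalIntegral.integral_add hintegrable_neg (hintegrable 0 π), besselI, ← mul_assoc,
    mul_inv_cancel_right₀ (ofReal_ne_zero.2 Real.pi_ne_zero),
    ← intervalIntegral.integral_const_mul]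
  congr 1 with θ
  rw [Real.cos_neg, ofReal_cos (n * θ), Complex.cos]
  push_cast
  ring_nf

/-- The Fourier expansion of `θ ↦ exp (t cos θ)`. -/
theorem hasSum_besselI_mul_exp (t : ℂ) (θ : ℝ) :
    HasSum (fun n : ℤ ↦ besselI n t * exp (n * θ * I)) (exp (t * Real.cos θ)) := by
  have : Fact (0 < 2 * π) := ⟨Real.two_pi_pos⟩
  have hper : Function.Periodic (fun θ : ℝ ↦ exp (t * Real.cos θ)) (2 * π) := fun θ ↦ by
    simp only [Real.cos_add_two_pi]
  let F : C(AddCircle (2 * π), ℂ) :=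
    ⟨hper.lift, continuous_coinduced_dom.mpr
      (by fun_prop : Continuous fun θ : ℝ ↦ exp (t * Real.cos θ))⟩
  have hF (θ : ℝ) : F θ = exp (t * Real.cos θ) := hper.lift_coe θ
  have hfourier (n : ℤ) (θ : ℝ) :
      fourier n (θ : AddCircle (2 * π)) = exp (n * θ * I) := by
    rw [fourier_coe_apply]
    congr 1
    push_cast
    field_simp
  have hcoeff : fourierCoeff F = fun n : ℤ ↦ besselI n t := by
    ext n
    rw [fourierCoeff_eq_intervalIntegral _ _ (-π), show -π + 2 * π = π by ring]
    simp only [hF, hfourier, smul_eq_mul, Int.cast_neg, neg_mul]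
    rw [integral_exp_mul_exp_cos, real_smul]
    push_cast
    field_simp
  have hs : Summable (fourierCoeff F) := hcoeff ▸ (summable_norm_besselI t).of_norm
  simpa only [hcoeff, hF, hfourier, smul_eq_mul] using
    has_pointwise_sum_fourier_series_of_summable hs (θ : AddCircle (2 * π))

theorem besselI_neg (x : ℝ) (t : ℂ) : besselI (-x) t = besselI x t := by
  simp [besselI]

/-- Orthogonality of the characters of `ℤ / mℤ`. -/
theorem sum_range_exp_two_pi_mul_div (m : ℕ) (hm : 0 < m) (l : ℤ) :
    ∑ j ∈ Finset.range m, exp (2 * π * I * l * j / m) = if (m : ℤ) ∣ l then (m : ℂ) else 0 := by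
  have hm' : (m : ℂ) ≠ 0 := by exact_mod_cast hm.ne'
  have hζ := Complex.isPrimitiveRoot_exp m hm.ne'
  set ζ := exp (2 * π * I / m)
  have hterm (j : ℕ) : exp (2 * π * I * l * j / m) = (ζ ^ l) ^ j := by
    rw [← exp_int_mul, ← exp_nat_mul]
    congr 1
    ring
  simp only [hterm]
  split_ifs with h
  · simp [(hζ.zpow_eq_one_iff_dvd l).2 h]
  · have hne : ζ ^ l ≠ 1 := mt (hζ.zpow_eq_one_iff_dvd l).1 h
    have hpow : (ζ ^ l) ^ m = 1 := by
      rw [← zpow_natCast, ← zpow_mul, mul_comm, zpow_mul, zpow_natCast, hζ.pow_eq_one, one_zpow]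
    have := mul_neg_geom_sum (ζ ^ l) m
    rw [hpow, sub_self] at this
    exact (mul_eq_zero.1 this).resolve_left (sub_ne_zero.2 hne.symm)

theorem hasSum_besselI_arithmetic_progression (m : ℕ) (hm : 0 < m) (x : ℤ) (t : ℂ) :
    HasSum (fun k : ℤ ↦ besselI ((x : ℝ) + (m : ℝ) * (k : ℝ)) t)
      ((m : ℂ)⁻¹ * ∑ j ∈ Finset.range m, exp (t * Real.cos (2 * π * (j : ℝ) / (m : ℝ))) *
        exp (2 * π * I * (x : ℝ) * (j : ℝ) / (m : ℝ))) := by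
  have hm' : (m : ℂ) ≠ 0 := by exact_mod_cast hm.ne'
  have hinj : Function.Injective fun k : ℤ ↦ -(x + m * k) := fun a b h ↦ by
    simpa [hm.ne'] using h
  have hsum := (hasSum_sum (s := Finset.range m) fun j _ ↦
    (hasSum_besselI_mul_exp t (2 * π * (j : ℝ) / (m : ℝ))).mul_right
      (exp (2 * π * I * (x : ℝ) * (j : ℝ) / (m : ℝ)))).mul_left (m : ℂ)⁻¹
  have hterm (n : ℤ) : (m : ℂ)⁻¹ * ∑ j ∈ Finset.range m,
      besselI n t * exp (n * (2 * π * (j : ℝ) / (m : ℝ) : ℝ) * I) *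
        exp (2 * π * I * (x : ℝ) * (j : ℝ) / (m : ℝ)) =
      if (m : ℤ) ∣ n + x then besselI n t else 0 := by
    have hchar (j : ℕ) : besselI n t * exp (n * (2 * π * (j : ℝ) / (m : ℝ) : ℝ) * I) *
        exp (2 * π * I * (x : ℝ) * (j : ℝ) / (m : ℝ)) =
        besselI n t * exp (2 * π * I * (n + x : ℤ) * j / m) := by
      rw [mul_assoc, ← exp_add]
      congr 2
      push_cast
      ring
    simp only [hchar]
    rw [← Finset.mul_sum, sum_range_exp_two_pi_mul_div m hm]
    split_ifs
    · field_simp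
    · simp
  simp only [hterm] at hsum
  rw [← hinj.hasSum_iff] at hsum
  · convert! hsum using 2 with k
    rw [Function.comp_apply, if_pos ⟨-k, by ring⟩, ← besselI_neg]
    push_cast
    rfl
  · intro n hn
    refine if_neg fun ⟨k, hk⟩ ↦ hn ⟨-k, ?_⟩
    simp only
    linarith

/-- for positive integers `m_1,…,m_n`, `x ∈ ℤ^n` and `t ∈ ℂ^n`:
`Σ_{k∈ℤ^n} ∏_j I_{x_j+m_j k_j}(t_j)
  = (1/(m_1⋯m_n)) Σ_{0 ≤ k_j ≤ m_j−1} ∏_j exp(t_j cos(2πk_j/m_j)) e^{2πi x_j k_j/m_j}`. -/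
theorem besselI_lattice_sum_discrete_torus (n : ℕ) (m : Fin n → ℕ) (hm : ∀ j, 0 < m j)
    (x : Fin n → ℤ) (t : Fin n → ℂ) :
    ∑' k : Fin n → ℤ, ∏ j, besselI ((x j : ℝ) + (m j : ℝ) * (k j : ℝ)) (t j) =
      ((∏ j, (m j : ℂ)))⁻¹ *
        ∑ k ∈ Fintype.piFinset (fun j => Finset.range (m j)),
          ∏ j, Complex.exp (t j * Real.cos (2 * Real.pi * (k j : ℝ) / (m j : ℝ))) *
            Complex.exp (2 * Real.pi * I * (x j : ℝ) * (k j : ℝ) / (m j : ℝ)) := by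
  have hsum (j : Fin n) := hasSum_besselI_arithmetic_progression (m j) (hm j) (x j) (t j)
  rw [(summable_norm_and_hasSum_pi_prod n
    (fun j (k : ℤ) ↦ besselI ((x j : ℝ) + (m j : ℝ) * (k : ℝ)) (t j))
    fun j ↦ (hsum j).summable.norm).2.tsum_eq]
  simp only [fun j ↦ (hsum j).tsum_eq]
  rw [Finset.prod_mul_distrib, Finset.prod_inv_distrib, Finset.prod_univ_sum]
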